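/- arXiv:1506.02440 — 4 statements merged into one kernel-verified Lean document; each statement's English description precedes it below -/
import Mathlib

section
/- For all covariant momenta p_*, q_* ∈ ℝ³ the quantity h² := −(p⁰−q⁰)² + g_{ab}u^a u^b is nonnegative and satisfies h² ≤ g_{ab}u^a u^b ≤ p⁰ q⁰ h². -/
open Matrix

/-- The energy `p⁰ = √(1 + g^{ab} p_a p_b)` of a covariant momentum `p` on the unit mass
shell, for a spatial metric with entries `g_{ab}` given by the matrix `g`. -/
noncomputable def energy (g : Matrix (Fin 3) (Fin 3) ℝ) (p : Fin 3 → ℝ) : ℝ :=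
  Real.sqrt (1 + p ⬝ᵥ (g⁻¹ *ᵥ p))

/-- The square `h²` of the relative momentum, `h² = −(p⁰−q⁰)² + g_{ab} u^a u^b`
with `u^a = p^a − q^a`.  Note `g_{ab} u^a u^b = g^{ab}(p−q)_a (p−q)_b`. -/
noncomputable def relMomSq (g : Matrix (Fin 3) (Fin 3) ℝ) (p q : Fin 3 → ℝ) : ℝ :=
  -(energy g p - energy g q) ^ 2 + (p - q) ⬝ᵥ (g⁻¹ *ᵥ (p - q))

/-- The bilinear form of a real symmetric matrix is symmetric. -/
theorem Matrix.IsHermitian.dotProduct_mulVec_symm {n : Type*} [Fintype n] {M : Matrix n n ℝ}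
    (hM : M.IsHermitian) (x y : n → ℝ) : x ⬝ᵥ (M *ᵥ y) = y ⬝ᵥ (M *ᵥ x) := by
  rw [dotProduct_mulVec, ← mulVec_transpose, dotProduct_comm,
    ← conjTranspose_eq_transpose_of_trivial, hM.eq]

/-- Cauchy–Schwarz for the bilinear form of a real positive semidefinite matrix. -/
theorem Matrix.PosSemidef.dotProduct_mulVec_sq_le {n : Type*} [Fintype n] {M : Matrix n n ℝ}
    (hM : M.PosSemidef) (x y : n → ℝ) :
    (x ⬝ᵥ (M *ᵥ y)) ^ 2 ≤ (x ⬝ᵥ (M *ᵥ x)) * (y ⬝ᵥ (M *ᵥ y)) := by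
  have hsymm : y ⬝ᵥ (M *ᵥ x) = x ⬝ᵥ (M *ᵥ y) := hM.isHermitian.dotProduct_mulVec_symm y x
  have hquad (t : ℝ) : 0 ≤ (y ⬝ᵥ (M *ᵥ y)) * (t * t) + (2 * (x ⬝ᵥ (M *ᵥ y))) * t
      + x ⬝ᵥ (M *ᵥ x) := by
    have h := hM.dotProduct_mulVec_nonneg (x + t • y)
    simp only [star_trivial, mulVec_add, mulVec_smul, dotProduct_add, add_dotProduct,
      dotProduct_smul, smul_dotProduct, smul_eq_mul, hsymm] at h
    linarith
  have h := discrim_le_zero hquad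
  rw [discrim] at h
  linarith

/-- For all covariant momenta `p, q ∈ ℝ³`, `h²` is nonnegative and satisfies
`h² ≤ g_{ab} u^a u^b ≤ p⁰ q⁰ h²`. -/
theorem stmt_1 (g : Matrix (Fin 3) (Fin 3) ℝ) (hg : g.PosDef) (p q : Fin 3 → ℝ) :
    0 ≤ relMomSq g p q ∧
    relMomSq g p q ≤ (p - q) ⬝ᵥ (g⁻¹ *ᵥ (p - q)) ∧
    (p - q) ⬝ᵥ (g⁻¹ *ᵥ (p - q)) ≤ energy g p * energy g q * relMomSq g p q := by
  have hM : (g⁻¹).PosSemidef := hg.inv.posSemidef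
  have hsymm : q ⬝ᵥ (g⁻¹ *ᵥ p) = p ⬝ᵥ (g⁻¹ *ᵥ q) := hM.isHermitian.dotProduct_mulVec_symm q p
  have hp : 0 ≤ p ⬝ᵥ (g⁻¹ *ᵥ p) := by simpa using hM.dotProduct_mulVec_nonneg p
  have hq : 0 ≤ q ⬝ᵥ (g⁻¹ *ᵥ q) := by simpa using hM.dotProduct_mulVec_nonneg q
  have hcs := hM.dotProduct_mulVec_sq_le p q
  have hu : (p - q) ⬝ᵥ (g⁻¹ *ᵥ (p - q)) =
      p ⬝ᵥ (g⁻¹ *ᵥ p) + q ⬝ᵥ (g⁻¹ *ᵥ q) - 2 * (p ⬝ᵥ (g⁻¹ *ᵥ q)) := by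
    simp only [mulVec_sub, dotProduct_sub, sub_dotProduct, hsymm]
    ring
  have hP : energy g p ^ 2 = 1 + p ⬝ᵥ (g⁻¹ *ᵥ p) := Real.sq_sqrt (by linarith)
  have hQ : energy g q ^ 2 = 1 + q ⬝ᵥ (g⁻¹ *ᵥ q) := Real.sq_sqrt (by linarith)
  have hP1 : 1 ≤ energy g p := Real.one_le_sqrt.2 (by linarith)
  have hQ1 : 1 ≤ energy g q := Real.one_le_sqrt.2 (by linarith)
  rw [relMomSq, hu]
  generalize energy g p = P at *
  generalize energy g q = Q at *
  generalize p ⬝ᵥ (g⁻¹ *ᵥ q) = c at *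
  rw [← sub_eq_iff_eq_add'] at hP hQ
  rw [← hP, ← hQ] at hcs ⊢
  have hc : c ≤ P * Q - 1 :=
    le_of_abs_le (abs_le_of_sq_le_sq (by nlinarith [sq_nonneg (P - Q)]) (by nlinarith))
  refine ⟨by nlinarith, by nlinarith [sq_nonneg (P - Q)], ?_⟩
  linear_combination hcs + sq_nonneg (P * Q - 1 - c)
end

section
/- For all covariant momenta p_*, q_* ∈ ℝ³, every orthonormal frame e for g, and every Euclidean unit vector ξ ∈ ℝ³ (|ξ| = 1): q⁰/p⁰ + p⁰/q⁰ ≤ s ≤ (n⁰)² − (n_a e^a_b ξ^b)². -/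
open Matrix

/-- The total energy `s = (n⁰)² − g_{ab} n^a n^b` with `n^a = p^a + q^a`, `n⁰ = p⁰ + q⁰`. -/
noncomputable def totEnergy (g : Matrix (Fin 3) (Fin 3) ℝ) (p q : Fin 3 → ℝ) : ℝ :=
  (energy g p + energy g q) ^ 2 - (p + q) ⬝ᵥ (g⁻¹ *ᵥ (p + q))

/-- The inverse metric is `e eᵀ` for every orthonormal frame `e`. -/
lemma inv_eq_mul_transpose_of_frame {n : Type*} [Fintype n] [DecidableEq n]
    {g e : Matrix n n ℝ} (he : eᵀ * g * e = 1) : g⁻¹ = e * eᵀ := by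
  have h : e * (eᵀ * g) = 1 := mul_eq_one_comm.mp he
  exact Matrix.inv_eq_left_inv (by rw [Matrix.mul_assoc, h])

/-- In an orthonormal frame the inverse metric is the Euclidean inner product. -/
lemma dotProduct_inv_mulVec_of_frame {n : Type*} [Fintype n] [DecidableEq n]
    {g e : Matrix n n ℝ} (he : eᵀ * g * e = 1) (p q : n → ℝ) :
    p ⬝ᵥ (g⁻¹ *ᵥ q) = (p ᵥ* e) ⬝ᵥ (q ᵥ* e) := by
  rw [inv_eq_mul_transpose_of_frame he, ← mulVec_mulVec, mulVec_transpose, dotProduct_mulVec]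

lemma dotProduct_sq_le {n : Type*} [Fintype n] (u v : n → ℝ) :
    (u ⬝ᵥ v) ^ 2 ≤ (u ⬝ᵥ u) * (v ⬝ᵥ v) := by
  simpa only [dotProduct, sq] using Finset.sum_mul_sq_le_sq_mul_sq Finset.univ u v

/-- The scalar inequality behind the lower bound on the total energy: `a`, `b` are squared
norms of two momenta, `c` is their inner product, and `P`, `Q` are their energies. -/
lemma div_add_div_le_of_mass_shell {P Q a b c : ℝ} (hP : 0 < P) (hQ : 0 < Q)
    (hPa : P ^ 2 = 1 + a) (hQb : Q ^ 2 = 1 + b) (ha : 0 ≤ a) (hb : 0 ≤ b)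
    (hc : c ^ 2 ≤ a * b) : Q / P + P / Q ≤ 2 + 2 * (P * Q) - 2 * c := by
  have hP1 : 1 ≤ P := by nlinarith
  have hQ1 : 1 ≤ Q := by nlinarith
  have hPQ : 1 ≤ P * Q := one_le_mul_of_one_le_of_one_le hP1 hQ1
  have hprod : (P * Q) ^ 2 = (1 + a) * (1 + b) := by rw [mul_pow, hPa, hQb]
  rw [div_add_div _ _ hP.ne' hQ.ne', div_le_iff₀ (mul_pos hP hQ)]
  nlinarith [sq_nonneg (P * Q - c)]

/-- For all covariant momenta `p, q ∈ ℝ³`, every orthonormal frame `e` for `g`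
(i.e. `g_{ab} e^a_c e^b_d = δ_{cd}`, where the matrix `e` has entries `e a b = e^a_b`),
and every Euclidean unit vector `ξ ∈ ℝ³`:
`q⁰/p⁰ + p⁰/q⁰ ≤ s ≤ (n⁰)² − (n_a e^a_b ξ^b)²`.
Here `n_a e^a_b ξ^b = (p+q) ⬝ᵥ (e *ᵥ ξ)` since `n_a = (p+q)_a`. -/
theorem stmt_2 (g : Matrix (Fin 3) (Fin 3) ℝ) (hg : g.PosDef)
    (e : Matrix (Fin 3) (Fin 3) ℝ) (he : eᵀ * g * e = 1)
    (ξ : Fin 3 → ℝ) (hξ : ξ ⬝ᵥ ξ = 1) (p q : Fin 3 → ℝ) :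
    energy g q / energy g p + energy g p / energy g q ≤ totEnergy g p q ∧
    totEnergy g p q ≤ (energy g p + energy g q) ^ 2 - ((p + q) ⬝ᵥ (e *ᵥ ξ)) ^ 2 := by
  have hsq : ∀ x : Fin 3 → ℝ, 0 ≤ x ⬝ᵥ x := fun x ↦ by
    simpa only [star_trivial] using dotProduct_star_self_nonneg x
  have henergy : ∀ x : Fin 3 → ℝ, energy g x ^ 2 = 1 + (x ᵥ* e) ⬝ᵥ (x ᵥ* e) := fun x ↦ by
    rw [energy, dotProduct_inv_mulVec_of_frame he, Real.sq_sqrt (by linarith [hsq (x ᵥ* e)])]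
  have hpos : ∀ x : Fin 3 → ℝ, 0 < energy g x := fun x ↦ by
    rw [energy, dotProduct_inv_mulVec_of_frame he]
    exact Real.sqrt_pos.mpr (by linarith [hsq (x ᵥ* e)])
  rw [totEnergy, dotProduct_inv_mulVec_of_frame he]
  constructor
  · have h := div_add_div_le_of_mass_shell (hpos p) (hpos q) (henergy p) (henergy q)
      (hsq _) (hsq _) (dotProduct_sq_le (p ᵥ* e) (q ᵥ* e))
    rw [add_vecMul, add_dotProduct, dotProduct_add, dotProduct_add,
      dotProduct_comm (q ᵥ* e) (p ᵥ* e)]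
    nlinarith [henergy p, henergy q]
  · have h := dotProduct_sq_le ((p + q) ᵥ* e) ξ
    rw [hξ, mul_one] at h
    rw [dotProduct_mulVec]
    linarith
end

section
/- Let t₀ > 0, let F, G : [t₀,∞) → [0,∞) be continuous with I := ∫_{t₀}^∞ (F(s)+G(s)) ds < ∞, and let H : [t₀,∞) → ℝ be C¹, positive, with H(t₀) = 2/(3t₀) and d/dt(1/H)(t) = 3/2 + F(t) + G(t) for all t ≥ t₀. Then H(t) = 1/((3/2)t + ∫_{t₀}^t (F+G)(s) ds) for all t ≥ t₀; in particular (2/3)t⁻¹ · 1/(1 + (2/3)I t⁻¹) ≤ H(t) ≤ (2/3)t⁻¹ and |H(t) − (2/3)t⁻¹| ≤ (4/9) I t⁻². -/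
open MeasureTheory

/-- Bounds on `1 / ((3/2) t + J)` for a perturbation `0 ≤ J ≤ I`. -/
lemma one_div_perturbed_bounds {t I J : ℝ} (ht : 0 < t) (hJ : 0 ≤ J) (hJI : J ≤ I) :
    2 / 3 * t⁻¹ * (1 / (1 + 2 / 3 * I * t⁻¹)) ≤ 1 / (3 / 2 * t + J) ∧
      1 / (3 / 2 * t + J) ≤ 2 / 3 * t⁻¹ ∧
      |1 / (3 / 2 * t + J) - 2 / 3 * t⁻¹| ≤ 4 / 9 * I / t ^ 2 := by
  have hI : 0 ≤ I := hJ.trans hJI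
  have hbase : 2 / 3 * t⁻¹ = 1 / (3 / 2 * t) := by field_simp
  have hupper : 1 / (3 / 2 * t + J) ≤ 2 / 3 * t⁻¹ := by
    rw [hbase]
    gcongr
    linarith
  refine ⟨?_, hupper, ?_⟩
  · have hlower : 2 / 3 * t⁻¹ * (1 / (1 + 2 / 3 * I * t⁻¹)) = 1 / (3 / 2 * t + I) := by
      field_simp
    rw [hlower]
    gcongr
  · rw [abs_of_nonpos (by linarith)]
    calc -(1 / (3 / 2 * t + J) - 2 / 3 * t⁻¹)
        = J / (3 / 2 * t * (3 / 2 * t + J)) := by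
          field_simp
          ring
      _ ≤ I / (3 / 2 * t * (3 / 2 * t)) := by
          gcongr
          linarith
      _ = 4 / 9 * I / t ^ 2 := by
          field_simp
          ring

/-- If the Hubble variable `H` is positive, `C¹`, normalized so that `H(t₀) = 2/(3t₀)`,
and satisfies `d(H⁻¹)/dt = 3/2 + F(t) + G(t)` with `F, G ≥ 0` continuous and integrable
on `[t₀,∞)` with total integral `I`, then `H(t) = 1/((3/2)t + ∫_{t₀}^t (F+G))`; in
particular `(2/3)t⁻¹/(1 + (2/3)I t⁻¹) ≤ H(t) ≤ (2/3)t⁻¹` and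
`|H(t) − (2/3)t⁻¹| ≤ (4/9) I t⁻²`. -/
theorem stmt_7 (t₀ : ℝ) (ht₀ : 0 < t₀) (F G H : ℝ → ℝ)
    (hFcont : ContinuousOn F (Set.Ici t₀)) (hGcont : ContinuousOn G (Set.Ici t₀))
    (hFnn : ∀ t ∈ Set.Ici t₀, 0 ≤ F t) (hGnn : ∀ t ∈ Set.Ici t₀, 0 ≤ G t)
    (hint : IntegrableOn (fun s => F s + G s) (Set.Ici t₀))
    (I : ℝ) (hI : I = ∫ s in Set.Ici t₀, (F s + G s))
    (hHpos : ∀ t ∈ Set.Ici t₀, 0 < H t)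
    (hH0 : H t₀ = 2 / (3 * t₀))
    (hC1 : ContDiffOn ℝ 1 H (Set.Ici t₀))
    (hder : ∀ t ∈ Set.Ici t₀,
      HasDerivWithinAt (fun s => (H s)⁻¹) (3 / 2 + F t + G t) (Set.Ici t₀) t) :
    ∀ t ∈ Set.Ici t₀,
      H t = 1 / (3 / 2 * t + ∫ s in t₀..t, (F s + G s)) ∧
      2 / 3 * t⁻¹ * (1 / (1 + 2 / 3 * I * t⁻¹)) ≤ H t ∧
      H t ≤ 2 / 3 * t⁻¹ ∧
      |H t - 2 / 3 * t⁻¹| ≤ 4 / 9 * I / t ^ 2 := by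
  intro t ht
  have hle : t₀ ≤ t := ht
  have hsub : Set.Ioc t₀ t ⊆ Set.Ici t₀ := fun x hx => hx.1.le
  have hFG : IntervalIntegrable (fun s => F s + G s) volume t₀ t :=
    (intervalIntegrable_iff_integrableOn_Ioc_of_le hle).2 (hint.mono_set hsub)
  have hftc : ∫ s in t₀..t, (3 / 2 + (F s + G s)) = (H t)⁻¹ - (H t₀)⁻¹ := by
    refine intervalIntegral.integral_eq_sub_of_hasDeriv_right_of_le (f := fun s => (H s)⁻¹) hle
      (fun x hx => ((hder x hx.1).continuousWithinAt).mono Set.Icc_subset_Ici_self)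
      (fun x hx => ?_) (intervalIntegrable_const.add hFG)
    rw [← add_assoc]
    exact (hder x hx.1.le).mono (Set.Ioi_subset_Ici hx.1.le)
  rw [intervalIntegral.integral_add intervalIntegrable_const hFG,
    intervalIntegral.integral_const, smul_eq_mul, hH0, inv_div] at hftc
  have hH : H t = 1 / (3 / 2 * t + ∫ s in t₀..t, (F s + G s)) := by
    rw [← inv_inv (H t), ← one_div]
    congr 1
    linarith
  have hJ : 0 ≤ ∫ s in t₀..t, (F s + G s) :=
    intervalIntegral.integral_nonneg hle fun s hs => add_nonneg (hFnn s hs.1) (hGnn s hs.1)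
  have hJI : ∫ s in t₀..t, (F s + G s) ≤ I := by
    rw [hI, intervalIntegral.integral_of_le hle]
    refine setIntegral_mono_set hint ?_ hsub.eventuallyLE
    filter_upwards [ae_restrict_mem measurableSet_Ici] with s hs
    exact add_nonneg (hFnn s hs) (hGnn s hs)
  have hbounds := one_div_perturbed_bounds (ht₀.trans_le hle) hJ hJI
  rw [← hH] at hbounds
  exact ⟨hH, hbounds⟩
end

section
/- Suppose the curve of metrics g(t) satisfies Assumption (A), fix t ≥ t₀ with g = g(t), e = e(t), and let ξ be a Euclidean unit vector. Define the post-collision momentum (Glassey–Strauss parametrization) p'_i = (p_i+q_i)/2 + (h/2) n⁰ g_{ia}e^a_bξ^b / √((n⁰)² − (n_c e^c_d ξ^d)²). Then for all covariant momenta p_* ≠ q_* and all i,k ∈ {1,2,3}: |∂_{p_k} p'_i| ≤ C p⁰ (q⁰)⁴, where C depends only on the constant in Assumption (A) and not on t, the metric, p_*, q_*, or ξ. -/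
open Matrix

/-- The Cholesky factor of a symmetric positive definite `3×3` matrix `g`: the lower
triangular matrix `θ` with positive diagonal such that `g = θ * θᵀ`, given by its
explicit formula in terms of the leading principal minors of `g`. -/
noncomputable def chol (g : Matrix (Fin 3) (Fin 3) ℝ) : Matrix (Fin 3) (Fin 3) ℝ :=
  !![g 0 0 / Real.sqrt (g 0 0), 0, 0;
     g 0 1 / Real.sqrt (g 0 0),
       (g 0 0 * g 1 1 - g 0 1 ^ 2) /
         (Real.sqrt (g 0 0) * Real.sqrt (g 0 0 * g 1 1 - g 0 1 ^ 2)), 0;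
     g 0 2 / Real.sqrt (g 0 0),
       (g 0 0 * g 1 2 - g 0 1 * g 0 2) /
         (Real.sqrt (g 0 0) * Real.sqrt (g 0 0 * g 1 1 - g 0 1 ^ 2)),
       g.det / (Real.sqrt (g 0 0 * g 1 1 - g 0 1 ^ 2) * Real.sqrt g.det)]

/-- The orthonormal frame `e^a_b` obtained from the Cholesky factorization,
satisfying `g_{ab} e^a_c e^b_d = δ_{cd}`; its inverse is `θ^a_b = (chol g)ᵀ`. -/
noncomputable def frameE (g : Matrix (Fin 3) (Fin 3) ℝ) : Matrix (Fin 3) (Fin 3) ℝ :=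
  ((chol g)ᵀ)⁻¹

/-- The relative momentum `h`. -/
noncomputable def relMom (g : Matrix (Fin 3) (Fin 3) ℝ) (p q : Fin 3 → ℝ) : ℝ :=
  Real.sqrt (-(energy g p - energy g q) ^ 2 + (p - q) ⬝ᵥ (g⁻¹ *ᵥ (p - q)))

/-- Assumption (A) on a curve of metrics `g(t)`, `t ≥ t₀ > 0`, with constant `CA` and
parameter `ε₁`: writing `g_{ab}(t) = t^{4/3}ḡ_{ab}(t)` and `g^{ab}(t) = t^{−4/3}ḡ^{ab}(t)`,
all entries satisfy `|ḡ_{ab}| ≤ CA`, `|ḡ^{ab}| ≤ CA`; the Cholesky orthonormal frame and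
its inverse satisfy `|e^a_b| ≤ CA t^{−2/3}`, `|θ^a_b| ≤ CA t^{2/3}`; and for some
`0 < ε₁ < 1/12`, `t ↦ t^{−ε₁} ḡ^{ab}(t) p_a p_b` is non-increasing for every `p`. -/
def AssumpA (t₀ CA ε₁ : ℝ) (g : ℝ → Matrix (Fin 3) (Fin 3) ℝ) : Prop :=
  (∀ t ∈ Set.Ici t₀, (g t).PosDef) ∧
  (∀ t ∈ Set.Ici t₀, ∀ a b : Fin 3,
    |t ^ (-(4 : ℝ) / 3) * g t a b| ≤ CA ∧
    |t ^ ((4 : ℝ) / 3) * (g t)⁻¹ a b| ≤ CA ∧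
    |frameE (g t) a b| ≤ CA * t ^ (-(2 : ℝ) / 3) ∧
    |(chol (g t))ᵀ a b| ≤ CA * t ^ ((2 : ℝ) / 3)) ∧
  (0 < ε₁ ∧ ε₁ < 1 / 12) ∧
  (∀ p : Fin 3 → ℝ,
    AntitoneOn (fun t => t ^ ((4 : ℝ) / 3 - ε₁) * (p ⬝ᵥ ((g t)⁻¹ *ᵥ p))) (Set.Ici t₀))


/-- The Glassey–Strauss post-collision momentum in covariant variables:
`p'_i = (p_i+q_i)/2 + (h/2) n⁰ g_{ia}e^a_bξ^b / √((n⁰)² − (n_ce^c_dξ^d)²)`. -/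
noncomputable def pGS (g : Matrix (Fin 3) (Fin 3) ℝ) (ξ p q : Fin 3 → ℝ) (i : Fin 3) : ℝ :=
  (p i + q i) / 2 + relMom g p q / 2 * (energy g p + energy g q) *
    (g *ᵥ (frameE g *ᵥ ξ)) i /
    Real.sqrt ((energy g p + energy g q) ^ 2 - ((p + q) ⬝ᵥ (frameE g *ᵥ ξ)) ^ 2)

section RelativisticKinematics

variable {E : Type*} [NormedAddCommGroup E]

/-- The energy of a particle of unit mass with momentum `u`, in an orthonormal frame. -/
noncomputable def unitMassEnergy (u : E) : ℝ := Real.sqrt (1 + ‖u‖ ^ 2)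

lemma unitMassEnergy_sq (u : E) : unitMassEnergy u ^ 2 = 1 + ‖u‖ ^ 2 :=
  Real.sq_sqrt (by positivity)

lemma one_le_unitMassEnergy (u : E) : 1 ≤ unitMassEnergy u :=
  Real.one_le_sqrt.2 (by nlinarith [sq_nonneg ‖u‖])

lemma norm_le_unitMassEnergy (u : E) : ‖u‖ ≤ unitMassEnergy u :=
  Real.le_sqrt_of_sq_le (by linarith)

variable [InnerProductSpace ℝ E]

lemma hasDerivAt_unitMassEnergy (u w : E) :
    HasDerivAt (fun x : ℝ => unitMassEnergy (u + x • w))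
      (inner ℝ u w / unitMassEnergy u) 0 := by
  have h1 : HasDerivAt (fun x : ℝ => u + x • w) w 0 := by
    simpa using ((hasDerivAt_id (0 : ℝ)).smul_const w).const_add u
  have h2 := (h1.norm_sq.const_add 1).sqrt (by positivity)
  refine h2.congr_deriv ?_
  simp only [zero_smul, add_zero, unitMassEnergy]
  field_simp

lemma dist_sq_le_relMom_sq_mul (u v : E) :
    ‖u - v‖ ^ 2 ≤ (-(unitMassEnergy u - unitMassEnergy v) ^ 2 + ‖u - v‖ ^ 2) *
      (unitMassEnergy u * unitMassEnergy v) := by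
  have ha := unitMassEnergy_sq u
  have hb := unitMassEnergy_sq v
  have hc : inner ℝ u v ^ 2 ≤ ‖u‖ ^ 2 * ‖v‖ ^ 2 := by
    rw [← mul_pow, ← sq_abs]
    exact pow_le_pow_left₀ (abs_nonneg _) (abs_real_inner_le_norm u v) 2
  rw [norm_sub_sq_real]
  generalize unitMassEnergy u = a at *
  generalize unitMassEnergy v = b at *
  generalize inner ℝ u v = c at *
  have hU : ‖u‖ ^ 2 = a ^ 2 - 1 := by linarith
  have hV : ‖v‖ ^ 2 = b ^ 2 - 1 := by linarith
  rw [hU, hV] at *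
  nlinarith [sq_nonneg (a * b - c - 1)]

lemma energy_le_totEnergy_mul (u v : E) :
    unitMassEnergy u ≤ ((unitMassEnergy u + unitMassEnergy v) ^ 2 - ‖u + v‖ ^ 2) *
      unitMassEnergy v := by
  have ha := unitMassEnergy_sq u
  have hb := unitMassEnergy_sq v
  have hb1 := one_le_unitMassEnergy v
  have ha1 := one_le_unitMassEnergy u
  have hua := norm_le_unitMassEnergy u
  have hvb := norm_le_unitMassEnergy v
  have hc := real_inner_le_norm u v
  rw [norm_add_sq_real]
  have hV := norm_nonneg v
  generalize unitMassEnergy u = a at *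
  generalize unitMassEnergy v = b at *
  generalize inner ℝ u v = c at *
  generalize ‖u‖ = U at *
  generalize ‖v‖ = V at *
  have h1 : 1 ≤ 2 * b * (b - V) := by nlinarith
  have h2 : U * V ≤ a * V := mul_le_mul_of_nonneg_right hua hV
  have h3 : a ≤ a * (2 * b * (b - V)) := by nlinarith
  have h4 : 0 ≤ b * (a * V - c) := mul_nonneg (by linarith) (by linarith)
  nlinarith

set_option maxHeartbeats 1000000 in
/-- The derivative of `h n⁰ / √((n⁰)² - (n·ξ)²)` with respect to one of the momenta. -/
lemma exists_hasDerivAt_glasseyStrauss {u v ξ : E} (huv : u ≠ v) (hξ : ‖ξ‖ = 1) (w : E) :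
    ∃ d, HasDerivAt (fun x : ℝ =>
        Real.sqrt (-(unitMassEnergy (u + x • w) - unitMassEnergy v) ^ 2 +
            ‖u + x • w - v‖ ^ 2) *
          (unitMassEnergy (u + x • w) + unitMassEnergy v) /
        Real.sqrt ((unitMassEnergy (u + x • w) + unitMassEnergy v) ^ 2 -
          inner ℝ (u + x • w + v) ξ ^ 2)) d 0 ∧
      |d| ≤ 13 * ‖w‖ * (unitMassEnergy u * unitMassEnergy v ^ 4) := by
  have hr := dist_sq_le_relMom_sq_mul u v
  have hs := energy_le_totEnergy_mul u v
  have hde := hasDerivAt_unitMassEnergy u w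
  have ha := unitMassEnergy_sq u
  have hb1 := one_le_unitMassEnergy v
  have ha1 := one_le_unitMassEnergy u
  have hua := norm_le_unitMassEnergy u
  have hvb := norm_le_unitMassEnergy v
  have hb := unitMassEnergy_sq v
  set a := unitMassEnergy u with ha_def
  set b := unitMassEnergy v with hb_def
  set r := ‖u - v‖ with hr_def
  have hr0 : 0 < r := norm_pos_iff.2 (sub_ne_zero.2 huv)
  set H := -(a - b) ^ 2 + r ^ 2 with hH_def
  have hH : 0 < H := by
    have : 0 < H * (a * b) := lt_of_lt_of_le (by positivity) hr
    exact pos_of_mul_pos_left this (by positivity)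
  set m := inner ℝ (u + v) ξ with hm_def
  have hm : |m| ≤ ‖u + v‖ := by
    simpa [hξ] using abs_real_inner_le_norm (u + v) ξ
  have hm2 : m ^ 2 ≤ ‖u + v‖ ^ 2 := by
    rw [← sq_abs]
    exact pow_le_pow_left₀ (abs_nonneg _) hm 2
  set S := (a + b) ^ 2 - m ^ 2 with hS_def
  have hSa : a ≤ S * b := hs.trans (mul_le_mul_of_nonneg_right (by linarith) (by linarith))
  have hS : 0 < S := pos_of_mul_pos_left (lt_of_lt_of_le (by linarith) hSa) (by linarith)
  have hHS : H ≤ S := by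
    have : r ^ 2 + ‖u + v‖ ^ 2 = 2 * (‖u‖ ^ 2 + ‖v‖ ^ 2) := by
      rw [hr_def, norm_sub_sq_real, norm_add_sq_real]; ring
    nlinarith
  set α := inner ℝ u w / a with hα_def
  have hline : HasDerivAt (fun x : ℝ => u + x • w) w 0 := by
    simpa using ((hasDerivAt_id (0 : ℝ)).smul_const w).const_add u
  set κ := b * α - inner ℝ v w with hκ_def
  set h := Real.sqrt H with hh_def
  set D := Real.sqrt S with hD_def
  have hh0 : 0 < h := Real.sqrt_pos.2 hH
  have hD0 : 0 < D := Real.sqrt_pos.2 hS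
  have hh2 : h ^ 2 = H := Real.sq_sqrt hH.le
  have hD2 : D ^ 2 = S := Real.sq_sqrt hS.le
  have hdh : HasDerivAt (fun x : ℝ => Real.sqrt
      (-(unitMassEnergy (u + x • w) - b) ^ 2 + ‖u + x • w - v‖ ^ 2)) (κ / h) 0 := by
    have h1 := (((hde.sub_const b).pow 2).neg.add (hline.sub_const v).norm_sq).sqrt
      (by simpa [← ha_def, ← hr_def] using hH.ne')
    refine h1.congr_deriv ?_
    have haα : a * α = inner ℝ u w := by rw [hα_def]; field_simp
    simp only [Pi.add_apply, Pi.neg_apply, Pi.pow_apply, zero_smul, add_zero, ← ha_def,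
      ← hr_def, ← hH_def, ← hh_def, inner_sub_left, ← haα, hκ_def]
    field_simp
    push_cast
    ring
  set β := (a + b) * α - m * inner ℝ w ξ with hβ_def
  have hdD : HasDerivAt (fun x : ℝ => Real.sqrt
      ((unitMassEnergy (u + x • w) + b) ^ 2 - inner ℝ (u + x • w + v) ξ ^ 2)) (β / D) 0 := by
    have h0 : HasDerivAt (fun x : ℝ => inner ℝ (u + x • w + v) ξ) (inner ℝ w ξ) 0 := by
      simpa using (hline.add_const v).inner ℝ (hasDerivAt_const (0 : ℝ) ξ)
    have h1 := (((hde.add_const b).pow 2).sub (h0.pow 2)).sqrt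
      (by simpa [← ha_def, ← hm_def] using hS.ne')
    refine h1.congr_deriv ?_
    simp only [Pi.sub_apply, Pi.pow_apply, zero_smul, add_zero, ← ha_def,
      ← hm_def, ← hS_def, ← hD_def, hβ_def]
    field_simp
    push_cast
    ring
  have hd := (hdh.mul (hde.add_const b)).div hdD
    (by simpa [← ha_def, ← hm_def] using hD0.ne')
  refine ⟨_, hd, ?_⟩
  simp only [Pi.mul_apply, zero_smul, add_zero, ← ha_def, ← hr_def, ← hH_def, ← hh_def,
    ← hm_def, ← hS_def, ← hD_def]
  have hW := norm_nonneg w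
  have hα : |α| ≤ ‖w‖ := by
    rw [hα_def, abs_div, abs_of_pos (by linarith : 0 < a), div_le_iff₀ (by linarith)]
    rw [mul_comm]
    exact (abs_real_inner_le_norm u w).trans (mul_le_mul_of_nonneg_right hua hW)
  have hhD : h ≤ D := Real.sqrt_le_sqrt hHS
  have hn : a + b ≤ 2 * (a * b) := by nlinarith
  have hκ : |κ| * a ≤ 2 * b * r * ‖w‖ := by
    have h1 : κ * a = inner ℝ (b • (u - v) + (b - a) • v) w := by
      simp only [inner_add_left, inner_smul_left, inner_sub_left, hκ_def, hα_def]
      simp only [conj_trivial]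
      field_simp
      ring
    have h2 : |a - b| ≤ r := abs_le_of_sq_le_sq (by linarith) hr0.le
    have h3 : ‖b • (u - v) + (b - a) • v‖ ≤ 2 * b * r := by
      refine (norm_add_le _ _).trans ?_
      rw [norm_smul, norm_smul, Real.norm_eq_abs, Real.norm_eq_abs, ← hr_def,
        abs_of_pos (by linarith : 0 < b), abs_sub_comm]
      have := mul_le_mul h2 hvb (norm_nonneg v) hr0.le
      linarith
    rw [← abs_of_pos (by linarith : 0 < a), ← abs_mul, h1]
    exact (abs_real_inner_le_norm _ _).trans (mul_le_mul_of_nonneg_right h3 hW)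
  have hrD : r ≤ h * D * b := by
    refine le_of_sq_le_sq ?_ (by positivity)
    calc r ^ 2 ≤ H * (a * b) := hr
      _ ≤ H * (S * b * b) := by gcongr
      _ = (h * D * b) ^ 2 := by rw [mul_pow, mul_pow, hh2, hD2]; ring
  have hκn : |κ| * (a + b) ≤ 4 * b ^ 3 * ‖w‖ * (h * D) := by
    have h1 : |κ| * a ≤ 2 * b * (h * D * b) * ‖w‖ := hκ.trans (by gcongr)
    calc |κ| * (a + b) ≤ |κ| * (2 * (a * b)) := by gcongr
      _ = 2 * b * (|κ| * a) := by ring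
      _ ≤ 2 * b * (2 * b * (h * D * b) * ‖w‖) := by gcongr
      _ = _ := by ring
  have hβ : |β| ≤ 2 * (a + b) * ‖w‖ := by
    have h1 : |m| ≤ a + b := hm.trans ((norm_add_le _ _).trans (by linarith))
    have h2 : |inner ℝ w ξ| ≤ ‖w‖ := by simpa [hξ] using abs_real_inner_le_norm w ξ
    calc |β| ≤ |(a + b) * α| + |m * inner ℝ w ξ| := abs_sub _ _
      _ = (a + b) * |α| + |m| * |inner ℝ w ξ| := by
        rw [abs_mul, abs_mul, abs_of_pos (by linarith : 0 < a + b)]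
      _ ≤ (a + b) * ‖w‖ + (a + b) * ‖w‖ := by gcongr
      _ = _ := by ring
  have hnD : (a + b) ^ 2 ≤ 4 * a * b ^ 3 * D ^ 2 := by
    calc (a + b) ^ 2 ≤ (2 * (a * b)) ^ 2 := by gcongr
      _ = 4 * a * b ^ 2 * a := by ring
      _ ≤ 4 * a * b ^ 2 * (S * b) := by gcongr
      _ = _ := by rw [hD2]; ring
  have hT1 : |κ / h * (a + b) / D| ≤ 4 * b ^ 3 * ‖w‖ := by
    rw [abs_div, abs_mul, abs_div, abs_of_pos hh0, abs_of_pos hD0,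
      abs_of_pos (by linarith : 0 < a + b), div_mul_eq_mul_div, div_div,
      div_le_iff₀ (by positivity)]
    exact hκn
  have hT2 : |h * α / D| ≤ ‖w‖ := by
    rw [abs_div, abs_mul, abs_of_pos hh0, abs_of_pos hD0, div_le_iff₀ hD0, mul_comm ‖w‖]
    gcongr
  have hT3 : |h * (a + b) * (β / D) / D ^ 2| ≤ 8 * a * b ^ 3 * ‖w‖ := by
    rw [abs_div, abs_mul, abs_mul, abs_div, abs_of_pos hh0, abs_of_pos hD0,
      abs_of_pos (by linarith : 0 < a + b), abs_of_pos (by positivity : 0 < D ^ 2),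
      div_le_iff₀ (by positivity), mul_div_assoc', div_le_iff₀ hD0]
    calc h * (a + b) * |β| ≤ D * (a + b) * (2 * (a + b) * ‖w‖) := by gcongr
      _ = D * 2 * ‖w‖ * (a + b) ^ 2 := by ring
      _ ≤ D * 2 * ‖w‖ * (4 * a * b ^ 3 * D ^ 2) := by gcongr
      _ = _ := by ring
  have hsplit : ((κ / h * (a + b) + h * α) * D - h * (a + b) * (β / D)) / D ^ 2 =
      κ / h * (a + b) / D + h * α / D - h * (a + b) * (β / D) / D ^ 2 := by
    field_simp
  rw [hsplit]
  have hb34 : b ^ 3 ≤ b ^ 4 := pow_le_pow_right₀ hb1 (by norm_num)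
  have hab : b ^ 4 ≤ a * b ^ 4 := le_mul_of_one_le_left (by positivity) ha1
  have hb4 : 1 ≤ b ^ 4 := one_le_pow₀ hb1
  calc _ ≤ 4 * b ^ 3 * ‖w‖ + ‖w‖ + 8 * a * b ^ 3 * ‖w‖ :=
        (abs_sub _ _).trans (add_le_add ((abs_add_le _ _).trans (add_le_add hT1 hT2)) hT3)
    _ = (4 * b ^ 3 + 1 + 8 * (a * b ^ 3)) * ‖w‖ := by ring
    _ ≤ (4 * (a * b ^ 4) + a * b ^ 4 + 8 * (a * b ^ 4)) * ‖w‖ := by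
        gcongr <;> linarith
    _ = _ := by ring

end RelativisticKinematics

lemma chol_mul_transpose {g : Matrix (Fin 3) (Fin 3) ℝ} (hg : g.PosDef) :
    chol g * (chol g)ᵀ = g := by
  have hsymm (i j : Fin 3) : g i j = g j i := by
    simpa using (hg.isHermitian.apply i j).symm
  have hdet := hg.det_pos
  have h0 : 0 < g 0 0 := hg.diag_pos
  have h1 : 0 < g 0 0 * g 1 1 - g 0 1 ^ 2 := by
    have h := hg.dotProduct_mulVec_pos (x := ![-g 0 1, g 0 0, 0])
      (fun h => h0.ne' (by simpa using congrFun h 1))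
    have h' : 0 < g 0 0 * (g 0 0 * g 1 1 - g 0 1 ^ 2) := by
      refine h.trans_eq ?_
      simp [Matrix.mulVec, dotProduct, Fin.sum_univ_three, hsymm 1 0]
      ring
    exact pos_of_mul_pos_right h' h0.le
  have s0 := Real.sq_sqrt h0.le
  have s1 := Real.sq_sqrt h1.le
  have s2 := Real.sq_sqrt hdet.le
  have p0 := Real.sqrt_pos.2 h0
  have p1 := Real.sqrt_pos.2 h1
  have p2 := Real.sqrt_pos.2 hdet
  have hd : g.det = g 0 0 * g 1 1 * g 2 2 - g 0 0 * g 1 2 ^ 2 - g 0 1 ^ 2 * g 2 2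
      + 2 * g 0 1 * g 0 2 * g 1 2 - g 0 2 ^ 2 * g 1 1 := by
    rw [Matrix.det_fin_three, hsymm 1 0, hsymm 2 0, hsymm 2 1]
    ring
  ext i j
  fin_cases i <;> fin_cases j <;>
    simp [chol, Matrix.mul_apply, Fin.sum_univ_three, hsymm 1 0, hsymm 2 0, hsymm 2 1] <;>
    field_simp <;> (try simp only [s0, s1, s2]) <;> (try rw [hd]) <;> ring

lemma isUnit_chol_transpose_det {g : Matrix (Fin 3) (Fin 3) ℝ} (hg : g.PosDef) :
    IsUnit (chol g)ᵀ.det := by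
  have h : g.det = (chol g).det * (chol g)ᵀ.det := by
    rw [← Matrix.det_mul, chol_mul_transpose hg]
  refine isUnit_iff_ne_zero.2 fun h0 => hg.det_pos.ne' ?_
  rw [h, h0, mul_zero]

lemma mul_frameE {g : Matrix (Fin 3) (Fin 3) ℝ} (hg : g.PosDef) : g * frameE g = chol g := by
  nth_rw 1 [← chol_mul_transpose hg]
  rw [frameE, Matrix.mul_assoc, Matrix.mul_nonsing_inv _ (isUnit_chol_transpose_det hg),
    Matrix.mul_one]

lemma frameE_mul_transpose {g : Matrix (Fin 3) (Fin 3) ℝ} (hg : g.PosDef) :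
    frameE g * (frameE g)ᵀ = g⁻¹ := by
  nth_rw 3 [← chol_mul_transpose hg]
  rw [Matrix.mul_inv_rev, frameE, Matrix.transpose_nonsing_inv, Matrix.transpose_transpose]

/-- The components of a covector in the orthonormal frame. -/
noncomputable def frameComponents (g : Matrix (Fin 3) (Fin 3) ℝ) :
    (Fin 3 → ℝ) →ₗ[ℝ] EuclideanSpace ℝ (Fin 3) :=
  (WithLp.linearEquiv 2 ℝ (Fin 3 → ℝ)).symm.toLinearMap ∘ₗ (frameE g)ᵀ.mulVecLin

lemma inner_frameComponents (g : Matrix (Fin 3) (Fin 3) ℝ) (p ξ : Fin 3 → ℝ) :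
    inner ℝ (frameComponents g p) (WithLp.toLp 2 ξ) = p ⬝ᵥ (frameE g *ᵥ ξ) := by
  rw [Matrix.dotProduct_mulVec, dotProduct_comm]
  simp [frameComponents, EuclideanSpace.inner_eq_star_dotProduct]

lemma norm_frameComponents_sq {g : Matrix (Fin 3) (Fin 3) ℝ} (hg : g.PosDef) (p : Fin 3 → ℝ) :
    ‖frameComponents g p‖ ^ 2 = p ⬝ᵥ (g⁻¹ *ᵥ p) := by
  rw [← frameE_mul_transpose hg, ← Matrix.mulVec_mulVec, ← inner_frameComponents,
    ← real_inner_self_eq_norm_sq]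
  rfl

lemma energy_eq_unitMassEnergy {g : Matrix (Fin 3) (Fin 3) ℝ} (hg : g.PosDef) (p : Fin 3 → ℝ) :
    energy g p = unitMassEnergy (frameComponents g p) := by
  rw [energy, unitMassEnergy, norm_frameComponents_sq hg]

lemma frameComponents_injective {g : Matrix (Fin 3) (Fin 3) ℝ} (hg : g.PosDef) :
    Function.Injective (frameComponents g) := by
  refine (injective_iff_map_eq_zero _).2 fun p hp => ?_
  by_contra hne
  have h := hg.inv.dotProduct_mulVec_pos hne
  rw [star_trivial, ← norm_frameComponents_sq hg, hp] at h
  simp at h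

lemma norm_le_of_forall_abs_le {x : EuclideanSpace ℝ (Fin 3)} {c : ℝ}
    (h : ∀ b, |x b| ≤ c) : ‖x‖ ≤ 2 * c := by
  have hc : 0 ≤ c := (abs_nonneg _).trans (h 0)
  refine le_of_sq_le_sq ?_ (by positivity)
  rw [EuclideanSpace.real_norm_sq_eq, Fin.sum_univ_three]
  have h2 (b : Fin 3) : x b ^ 2 ≤ c ^ 2 := sq_le_sq' (abs_le.1 (h b)).1 (abs_le.1 (h b)).2
  nlinarith [h2 0, h2 1, h2 2]

/-- The bound for a single metric, in terms of bounds on the frame and its inverse. -/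
lemma abs_deriv_pGS_le {g : Matrix (Fin 3) (Fin 3) ℝ} (hg : g.PosDef) {ce cθ : ℝ}
    (he : ∀ a b, |frameE g a b| ≤ ce) (hθ : ∀ a b, |(chol g)ᵀ a b| ≤ cθ)
    {p q ξ : Fin 3 → ℝ} (hpq : p ≠ q) (hξ : ξ ⬝ᵥ ξ = 1) (i k : Fin 3) :
    |deriv (fun x => pGS g ξ (Function.update p k x) q i) (p k)| ≤
      (1 + 26 * (cθ * ce)) * energy g p * energy g q ^ 4 := by
  have hξ' : ‖(WithLp.toLp 2 ξ : EuclideanSpace ℝ (Fin 3))‖ = 1 := by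
    rw [← sq_eq_sq₀ (norm_nonneg _) zero_le_one, one_pow, EuclideanSpace.real_norm_sq_eq, ← hξ]
    simp [dotProduct, pow_two]
  set φ := frameComponents g with hφ
  set w := φ (Pi.single k 1) with hw
  obtain ⟨d, hd, hdle⟩ := exists_hasDerivAt_glasseyStrauss
    ((frameComponents_injective hg).ne hpq) hξ' w
  set A := (g *ᵥ (frameE g *ᵥ ξ)) i with hA
  have hupd (x : ℝ) : Function.update p k x = p + (x - p k) • Pi.single k 1 := by
    ext j
    by_cases hj : j = k
    · subst hj; simp
    · simp [hj]
  have hφupd (x : ℝ) : φ (Function.update p k x) = φ p + (x - p k) • w := by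
    rw [hupd, map_add, map_smul]
  have hpi : HasDerivAt (fun x => (Function.update p k x i + q i) / 2)
      ((Pi.single k 1 : Fin 3 → ℝ) i / 2) (p k) := by
    simp only [hupd, Pi.add_apply, Pi.smul_apply, smul_eq_mul]
    simpa using (((((hasDerivAt_id (p k)).sub_const (p k)).mul_const
      ((Pi.single k 1 : Fin 3 → ℝ) i)).const_add (p i)).add_const (q i)).div_const 2
  have hd' := HasDerivAt.comp_sub_const (p k) (p k) (by rwa [sub_self])
  have hF : HasDerivAt (fun x => pGS g ξ (Function.update p k x) q i)
      ((Pi.single k 1 : Fin 3 → ℝ) i / 2 + d * (A / 2)) (p k) := by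
    refine (hpi.add (hd'.mul_const (A / 2))).congr_of_eventuallyEq (.of_forall fun x => ?_)
    simp only [Pi.add_apply]
    rw [← hφupd, ← map_sub, ← map_add, hφ, inner_frameComponents, norm_frameComponents_sq hg,
      ← energy_eq_unitMassEnergy hg, ← energy_eq_unitMassEnergy hg, pGS, relMom]
    ring
  rw [hF.deriv]
  rw [← energy_eq_unitMassEnergy hg, ← energy_eq_unitMassEnergy hg] at hdle
  have hwle : ‖w‖ ≤ 2 * ce := norm_le_of_forall_abs_le fun b => by
    simpa [hw, hφ, frameComponents] using he k b
  have hAle : |A| ≤ 2 * cθ := by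
    have h1 : A = inner ℝ (WithLp.toLp 2 fun b => chol g i b : EuclideanSpace ℝ (Fin 3))
        (WithLp.toLp 2 ξ) := by
      rw [hA, Matrix.mulVec_mulVec, mul_frameE hg]
      simp [EuclideanSpace.inner_eq_star_dotProduct, Matrix.mulVec, dotProduct_comm]
    rw [h1]
    refine (abs_real_inner_le_norm _ _).trans ?_
    rw [hξ', mul_one]
    exact norm_le_of_forall_abs_le fun b => by simpa using hθ b i
  have hsingle : |(Pi.single k 1 : Fin 3 → ℝ) i / 2| ≤ 1 := by
    by_cases hik : i = k
    · subst hik; norm_num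
    · simp [hik]
  have hp1 : 1 ≤ energy g p := energy_eq_unitMassEnergy hg p ▸ one_le_unitMassEnergy _
  have hq1 : 1 ≤ energy g q := energy_eq_unitMassEnergy hg q ▸ one_le_unitMassEnergy _
  have hpq1 : 1 ≤ energy g p * energy g q ^ 4 :=
    one_le_mul_of_one_le_of_one_le hp1 (one_le_pow₀ hq1)
  have hcθ : 0 ≤ cθ := (abs_nonneg _).trans (hθ 0 0)
  calc _ ≤ |(Pi.single k 1 : Fin 3 → ℝ) i / 2| + |d| * (|A| / 2) := by
        refine (abs_add_le _ _).trans_eq ?_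
        rw [abs_mul, abs_div A, abs_two]
    _ ≤ energy g p * energy g q ^ 4 +
        13 * (2 * ce) * (energy g p * energy g q ^ 4) * (2 * cθ / 2) := by
        refine add_le_add (hsingle.trans hpq1) (mul_le_mul (hdle.trans ?_) ?_ ?_ ?_)
        · gcongr
        · gcongr
        · positivity
        · have := (norm_nonneg w).trans hwle
          positivity
    _ = _ := by ring

/-- Under Assumption (A), the Glassey–Strauss post-collision momentum satisfies
`|∂_{p_k} p'_i| ≤ C p⁰ (q⁰)⁴` with `C` depending only on the constant in
Assumption (A), and not on `t`, the metric, the momenta, or `ξ`. -/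
theorem stmt_13 (t₀ CA ε₁ : ℝ) (ht₀ : 0 < t₀) (hCA : 0 < CA) :
    ∃ C > 0, ∀ g : ℝ → Matrix (Fin 3) (Fin 3) ℝ, AssumpA t₀ CA ε₁ g →
      ∀ t ∈ Set.Ici t₀, ∀ p q : Fin 3 → ℝ, p ≠ q →
      ∀ ξ : Fin 3 → ℝ, ξ ⬝ᵥ ξ = 1 → ∀ i k : Fin 3,
      |deriv (fun x => pGS (g t) ξ (Function.update p k x) q i) (p k)|
        ≤ C * energy (g t) p * (energy (g t) q) ^ 4 := by
  refine ⟨1 + 26 * CA ^ 2, by positivity, fun g hA t ht p q hpq ξ hξ i k => ?_⟩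
  have htpos : 0 < t := ht₀.trans_le ht
  have h := abs_deriv_pGS_le (hA.1 t ht) (fun a b => (hA.2.1 t ht a b).2.2.1)
    (fun a b => (hA.2.1 t ht a b).2.2.2) hpq hξ i k
  have hscale : CA * t ^ ((2 : ℝ) / 3) * (CA * t ^ (-(2 : ℝ) / 3)) = CA ^ 2 := by
    rw [mul_mul_mul_comm, ← Real.rpow_add htpos]
    norm_num
    ring
  rwa [hscale] at h
end
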